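/- arXiv:2508.06705 — 2 statements merged into one kernel-verified Lean document; each statement's English description precedes it below -/
import Mathlib

section
/- Fix i ∈ {1,2}. For ALL parameters (r₁,s₁), (r₂,s₂), (r₃,s₃) ∈ ℝ², writing u_j = u^{(i)}_{r_j,s_j}, one has dim(Ad(u₁ᵀ)(𝔯ᵢ^{(1)}) + Ad(u₂ᵀ)(𝔯ᵢ^{(1)}) + Ad(u₃ᵀ)(𝔯ᵢ^{(1)})) ≤ 8 and dim(Ad(u₁ᵀ)(𝔯ᵢ^{(0)}) ∩ Ad(u₂ᵀ)(𝔯ᵢ^{(0)}) ∩ Ad(u₃ᵀ)(𝔯ᵢ^{(0)})) ≥ 1. -/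
open Matrix MeasureTheory
open scoped Classical

noncomputable section

abbrev M4 : Type := Matrix (Fin 4) (Fin 4) ℝ

/-- trace inner product ⟨X,Y⟩ = tr(XYᵀ) -/
def tinner (X Y : M4) : ℝ := (X * Yᵀ).trace

/-- sup norm: maximum absolute value of entries -/
def mnorm (X : M4) : ℝ := ⨆ p : Fin 4 × Fin 4, |X p.1 p.2|

/-- Euclidean (Frobenius) norm -/
def mnorm2 (X : M4) : ℝ := Real.sqrt (tinner X X)

/-- Gram matrices Q₁ (i=0) and Q₂ (i=1) -/
def Qmat (i : Fin 2) : M4 :=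
  if i = 0 then !![0,0,0,-(1/2); 0,0,1/2,0; 0,1/2,0,0; -(1/2),0,0,0]
  else !![0,0,0,-1; 0,1,0,0; 0,0,1,0; -1,0,0,0]

/-- 𝔰𝔩₄(ℝ) as a submodule of 4×4 matrices -/
def sl4 : Submodule ℝ M4 where
  carrier := {X | X.trace = 0}
  add_mem' := by
    intro a b ha hb
    simp only [Set.mem_setOf_eq] at *
    simp [Matrix.trace_add, ha, hb]
  zero_mem' := by simp
  smul_mem' := by
    intro c x hx
    simp only [Set.mem_setOf_eq] at *
    simp [Matrix.trace_smul, hx]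

/-- the involution σᵢ(X) = −QᵢXᵀQᵢ⁻¹ as a linear map -/
def sigmaMap (i : Fin 2) : M4 →ₗ[ℝ] M4 where
  toFun X := -(Qmat i * Xᵀ * (Qmat i)⁻¹)
  map_add' X Y := by
    simp [Matrix.transpose_add, add_mul, mul_add]; abel
  map_smul' c X := by
    simp [Matrix.transpose_smul, Matrix.smul_mul, Matrix.mul_smul]

/-- 𝔯ᵢ = {X ∈ 𝔰𝔩₄ : σᵢ(X) = −X} -/
def rSpace (i : Fin 2) : Submodule ℝ M4 :=
  sl4 ⊓ LinearMap.ker (sigmaMap i + (LinearMap.id : M4 →ₗ[ℝ] M4))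

/-- 𝔥ᵢ = {X ∈ 𝔰𝔩₄ : σᵢ(X) = X} -/
def hSpace (i : Fin 2) : Submodule ℝ M4 :=
  sl4 ⊓ LinearMap.ker (sigmaMap i - (LinearMap.id : M4 →ₗ[ℝ] M4))

/-- 𝐚 = diag(1,0,0,−1) -/
def aWt : M4 := Matrix.diagonal ![1,0,0,-1]

/-- ad(𝐚) = [𝐚, ·] -/
def adA : M4 →ₗ[ℝ] M4 where
  toFun X := aWt * X - X * aWt
  map_add' X Y := by simp [mul_add, add_mul]; abel
  map_smul' c X := by simp [Matrix.mul_smul, Matrix.smul_mul, smul_sub]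

/-- weight space (𝔯ᵢ)_λ -/
def wSpace (i : Fin 2) (lam : ℤ) : Submodule ℝ M4 :=
  rSpace i ⊓ LinearMap.ker (adA - (lam : ℝ) • (LinearMap.id : M4 →ₗ[ℝ] M4))

/-- 𝔯ᵢ^{(λ)} = ⊕_{μ ≥ λ} (𝔯ᵢ)_μ -/
def rUp (i : Fin 2) (lam : ℤ) : Submodule ℝ M4 :=
  ⨆ (μ : ℤ) (_ : lam ≤ μ), wSpace i μ

/-- a_t = diag(e^t, 1, 1, e^{−t}) -/
def aMat (t : ℝ) : M4 := Matrix.diagonal ![Real.exp t, 1, 1, Real.exp (-t)]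

/-- the unipotent elements u^{(i)}_{r,s} -/
def uMat (i : Fin 2) (r s : ℝ) : M4 :=
  if i = 0 then !![1, r, s, s*r; 0,1,0,s; 0,0,1,r; 0,0,0,1]
  else !![1, r, s, (r^2+s^2)/2; 0,1,0,r; 0,0,1,s; 0,0,0,1]

/-- adjoint action g.X = gXg⁻¹ -/
def Adm (g X : M4) : M4 := g * X * g⁻¹

/-- adjoint action as a linear map -/
def AdLin (g : M4) : M4 →ₗ[ℝ] M4 where
  toFun X := g * X * g⁻¹
  map_add' X Y := by simp [mul_add, add_mul]
  map_smul' c X := by simp [Matrix.mul_smul, Matrix.smul_mul]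

/-- the parameter square [−1,1]² -/
def uSq : Set (ℝ × ℝ) := Set.Icc (-1 : ℝ) 1 ×ˢ Set.Icc (-1 : ℝ) 1

/-- m_U = (1/4)·(Lebesgue measure in the parameters) -/
def mU (S : Set (ℝ × ℝ)) : ENNReal := volume S / 4

/-- modified α-energy 𝒢^{(α)}_{F,δ}(w) -/
def energy (α δ : ℝ) (F : Finset M4) (w : M4) : ℝ :=
  ∑ w' ∈ F.erase w, (max (mnorm (w' - w)) δ) ^ (-α)

/-- φ(α) = (1/36)·min{(8/9)α, 1 − α/9} -/
def phiFn (α : ℝ) : ℝ := (1/36) * min ((8/9)*α) (1 - α/9)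

/-- δ-covering number by closed balls for the sup norm -/
def covNum (δ : ℝ) (A : Set M4) : ℕ :=
  sInf {n : ℕ | ∃ t : Finset M4, t.card = n ∧ A ⊆ ⋃ c ∈ t, {y : M4 | mnorm (y - c) ≤ δ}}

/-- orthonormal basis of a subspace, as a tuple -/
def IsONB {n : Type} [Fintype n] (v : n → M4) (V : Submodule ℝ M4) : Prop :=
  (∀ k, v k ∈ V) ∧ (∀ k l, tinner (v k) (v l) = if k = l then 1 else 0) ∧
    Submodule.span ℝ (Set.range v) = V

/-- Gram matrix of a tuple of vectors -/
def gram {n : Type} [Fintype n] (v : n → M4) : Matrix n n ℝ :=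
  Matrix.of fun a b => tinner (v a) (v b)

/-- weights λ₁,…,λ₅ = −2,…,2 -/
def lamOf : Fin 5 → ℤ := ![-2,-1,0,1,2]

/-- dimension differences 𝖽 = (1,2,3,2,1) -/
def dOf : Fin 5 → ℝ := ![1,2,3,2,1]

/-- Index of the atom of 𝒟^𝐫_ρ containing x, for an adapted orthonormal basis b with weights wt. -/
def atomIdx (b : Fin 9 → M4) (wt : Fin 9 → ℤ) (r : Fin 5 → ℝ) (ρ : ℝ) (x : M4) :
    Fin 5 → Fin 9 → ℤ :=
  fun j k => if lamOf j ≤ wt k then ⌊ tinner x (b k) / ρ ^ (r j) ⌋ else 0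

end

/-- The explicit inverse of `Qmat i`. -/
noncomputable def Qdual (i : Fin 2) : M4 :=
  if i = 0 then !![0,0,0,-2; 0,0,2,0; 0,2,0,0; -2,0,0,0]
  else !![0,0,0,-1; 0,1,0,0; 0,0,1,0; -1,0,0,0]

lemma Qmat_inv (i : Fin 2) : (Qmat i)⁻¹ = Qdual i := by
  apply Matrix.inv_eq_right_inv
  fin_cases i <;> ext a b <;> fin_cases a <;> fin_cases b <;>
    simp [Qmat, Qdual, Matrix.mul_apply, Fin.sum_univ_four]

lemma mem_rSpace {i : Fin 2} {Y : M4} :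
    Y ∈ rSpace i ↔ Y.trace = 0 ∧ Y = Qmat i * Yᵀ * Qdual i := by
  simp only [rSpace, sl4, sigmaMap, Submodule.mem_inf, LinearMap.mem_ker, LinearMap.add_apply,
    LinearMap.id_apply, Qmat_inv, Submodule.mem_mk, AddSubmonoid.mem_mk, AddSubsemigroup.mem_mk,
    Set.mem_ofPred_eq, LinearMap.coe_mk, AddHom.coe_mk, neg_add_eq_zero]
  exact and_congr_right fun _ => eq_comm

lemma Qmat_zero_mul_transpose_mul_Qdual (Y : M4) :
    Qmat 0 * Yᵀ * Qdual 0 = !![Y 3 3, -Y 2 3, -Y 1 3, Y 0 3; -Y 3 2, Y 2 2, Y 1 2, -Y 0 2;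
      -Y 3 1, Y 2 1, Y 1 1, -Y 0 1; Y 3 0, -Y 2 0, -Y 1 0, Y 0 0] := by
  ext a b
  simp only [Matrix.mul_apply, Fin.sum_univ_four]
  fin_cases a <;> fin_cases b <;> simp [Qmat, Qdual] <;> ring

lemma Qmat_one_mul_transpose_mul_Qdual (Y : M4) :
    Qmat 1 * Yᵀ * Qdual 1 = !![Y 3 3, -Y 1 3, -Y 2 3, Y 0 3; -Y 3 1, Y 1 1, Y 2 1, -Y 0 1;
      -Y 3 2, Y 1 2, Y 2 2, -Y 0 2; Y 3 0, -Y 1 0, -Y 2 0, Y 0 0] := by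
  ext a b
  simp only [Matrix.mul_apply, Fin.sum_univ_four]
  fin_cases a <;> fin_cases b <;> simp [Qmat, Qdual]

lemma mem_wSpace {i : Fin 2} {μ : ℤ} {Y : M4} :
    Y ∈ wSpace i μ ↔ Y ∈ rSpace i ∧ ∀ a b : Fin 4,
      ((![1, 0, 0, -1] : Fin 4 → ℝ) a - (![1, 0, 0, -1] : Fin 4 → ℝ) b - μ) * Y a b = 0 := by
  simp only [wSpace, adA, Submodule.mem_inf, LinearMap.mem_ker, LinearMap.sub_apply,
    LinearMap.coe_mk, AddHom.coe_mk, LinearMap.smul_apply, LinearMap.id_apply]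
  refine and_congr_right fun _ => ?_
  rw [← Matrix.ext_iff]
  refine forall₂_congr fun a b => ?_
  simp only [aWt, Matrix.sub_apply, Matrix.diagonal_mul, Matrix.mul_diagonal,
    Matrix.smul_apply, smul_eq_mul, Matrix.zero_apply]
  rw [← sub_eq_zero (b := (0 : ℝ)), sub_zero]
  constructor <;> intro h <;> linear_combination h

lemma transpose_uMat_mul_neg (i : Fin 2) (r s : ℝ) :
    (uMat i r s)ᵀ * (uMat i (-r) (-s))ᵀ = 1 := by
  fin_cases i <;> ext a b <;> fin_cases a <;> fin_cases b <;>
    simp [uMat, Matrix.mul_apply, Fin.sum_univ_four] <;> ring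

lemma isUnit_det_transpose_uMat (i : Fin 2) (r s : ℝ) : IsUnit (uMat i r s)ᵀ.det :=
  Matrix.isUnit_det_of_right_inverse (transpose_uMat_mul_neg i r s)

lemma transpose_uMat_mul_Qdual_mul (i : Fin 2) (r s : ℝ) :
    (uMat i r s)ᵀ * Qdual i * uMat i r s = Qdual i := by
  fin_cases i <;> ext a b <;> fin_cases a <;> fin_cases b <;>
    simp [uMat, Qdual, Matrix.mul_apply, Fin.sum_univ_four] <;> ring

lemma uMat_mul_Qdual_mul_transpose (i : Fin 2) (r s : ℝ) :
    uMat i r s * Qdual i * (uMat i r s)ᵀ = Qdual i := by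
  fin_cases i <;> ext a b <;> fin_cases a <;> fin_cases b <;>
    simp [uMat, Qdual, Matrix.mul_apply, Fin.sum_univ_four] <;> ring

lemma transpose_uMat_mul_Qmat_mul (i : Fin 2) (r s : ℝ) :
    (uMat i r s)ᵀ * Qmat i * uMat i r s = Qmat i := by
  fin_cases i <;> ext a b <;> fin_cases a <;> fin_cases b <;>
    simp [uMat, Qmat, Matrix.mul_apply, Fin.sum_univ_four] <;> ring

/-- The traceless part of the rank-one operator `Q⁻¹ p pᵀ`. -/
noncomputable def rankOne (i : Fin 2) (p : Fin 4 → ℝ) : M4 :=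
  Qdual i * vecMulVec p p - ((p ⬝ᵥ Qdual i *ᵥ p) / 4) • 1

lemma rankOne_zero (p : Fin 4 → ℝ) :
    rankOne 0 p = !![-(p 0 * p 3) - p 1 * p 2, -2 * p 1 * p 3, -2 * p 2 * p 3, -2 * p 3 ^ 2;
      2 * p 0 * p 2, p 1 * p 2 + p 0 * p 3, 2 * p 2 ^ 2, 2 * p 2 * p 3;
      2 * p 0 * p 1, 2 * p 1 ^ 2, p 1 * p 2 + p 0 * p 3, 2 * p 1 * p 3;
      -2 * p 0 ^ 2, -2 * p 0 * p 1, -2 * p 0 * p 2, -(p 0 * p 3) - p 1 * p 2] := by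
  ext a b
  rw [rankOne, Matrix.sub_apply, Matrix.mul_apply]
  fin_cases a <;> fin_cases b <;>
    simp [Fin.sum_univ_four, vecMulVec_apply, Qdual, dotProduct, mulVec] <;> ring

lemma rankOne_one (p : Fin 4 → ℝ) :
    rankOne 1 p = !![-(p 0 * p 3) / 2 - (p 1 ^ 2 + p 2 ^ 2) / 4, -p 1 * p 3, -p 2 * p 3, -p 3 ^ 2;
      p 0 * p 1, p 0 * p 3 / 2 + (3 * p 1 ^ 2 - p 2 ^ 2) / 4, p 1 * p 2, p 1 * p 3;
      p 0 * p 2, p 1 * p 2, p 0 * p 3 / 2 + (3 * p 2 ^ 2 - p 1 ^ 2) / 4, p 2 * p 3;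
      -p 0 ^ 2, -p 0 * p 1, -p 0 * p 2, -(p 0 * p 3) / 2 - (p 1 ^ 2 + p 2 ^ 2) / 4] := by
  ext a b
  rw [rankOne, Matrix.sub_apply, Matrix.mul_apply]
  fin_cases a <;> fin_cases b <;>
    simp [Fin.sum_univ_four, vecMulVec_apply, Qdual, dotProduct, mulVec] <;> ring

lemma rankOne_mem_rSpace (i : Fin 2) (p : Fin 4 → ℝ) : rankOne i p ∈ rSpace i := by
  rw [mem_rSpace]
  rcases (by omega : i = 0 ∨ i = 1) with rfl | rfl
  · rw [Qmat_zero_mul_transpose_mul_Qdual, rankOne_zero]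
    constructor
    · simp [Matrix.trace, Fin.sum_univ_four]
      ring
    · ext a b
      fin_cases a <;> fin_cases b <;> simp
  · rw [Qmat_one_mul_transpose_mul_Qdual, rankOne_one]
    constructor
    · simp [Matrix.trace, Fin.sum_univ_four]
      ring
    · ext a b
      fin_cases a <;> fin_cases b <;> simp

lemma AdLin_rankOne (i : Fin 2) (r s : ℝ) (p : Fin 4 → ℝ) :
    AdLin (uMat i r s)ᵀ (rankOne i (uMat i r s *ᵥ p)) = rankOne i p := by
  have hu := isUnit_det_transpose_uMat i r s
  have hQ := transpose_uMat_mul_Qdual_mul i r s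
  have h1 : vecMulVec (uMat i r s *ᵥ p) (uMat i r s *ᵥ p)
      = uMat i r s * vecMulVec p p * (uMat i r s)ᵀ := by
    rw [Matrix.mul_vecMulVec, Matrix.vecMulVec_mul, Matrix.vecMul_transpose]
  have h2 : (uMat i r s *ᵥ p) ⬝ᵥ Qdual i *ᵥ (uMat i r s *ᵥ p) = p ⬝ᵥ Qdual i *ᵥ p := by
    conv_rhs => rw [← hQ]
    rw [← Matrix.mulVec_mulVec, ← Matrix.mulVec_mulVec, Matrix.dotProduct_mulVec p,
      Matrix.vecMul_transpose]
  change (uMat i r s)ᵀ * rankOne i (uMat i r s *ᵥ p) * (uMat i r s)ᵀ⁻¹ = _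
  rw [rankOne, h1, h2, Matrix.mul_sub, Matrix.sub_mul, Matrix.mul_smul, Matrix.smul_mul,
    Matrix.mul_one, Matrix.mul_nonsing_inv _ hu, rankOne]
  congr 1
  calc _ = ((uMat i r s)ᵀ * Qdual i * uMat i r s) * vecMulVec p p *
        ((uMat i r s)ᵀ * (uMat i r s)ᵀ⁻¹) := by simp only [Matrix.mul_assoc]
    _ = _ := by rw [hQ, Matrix.mul_nonsing_inv _ hu, Matrix.mul_one]

lemma rankOne_mem_rUp_zero (i : Fin 2) (p : Fin 4 → ℝ) (hp : p 0 = 0) :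
    rankOne i p ∈ rUp i 0 := by
  set X := rankOne i p with hX
  have key (μ : ℤ) (hμ : 0 ≤ μ) (Y : M4) (hY : Y ∈ wSpace i μ) : Y ∈ rUp i 0 :=
    Submodule.mem_iSup_of_mem μ (Submodule.mem_iSup_of_mem hμ hY)
  have hsum : X = !![X 0 0, 0, 0, 0; 0, X 1 1, X 1 2, 0; 0, X 2 1, X 2 2, 0; 0, 0, 0, X 3 3]
      + !![0, X 0 1, X 0 2, 0; 0, 0, 0, X 1 3; 0, 0, 0, X 2 3; 0, 0, 0, 0]
      + !![0, 0, 0, X 0 3; 0, 0, 0, 0; 0, 0, 0, 0; 0, 0, 0, 0] := by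
    rcases (by omega : i = 0 ∨ i = 1) with rfl | rfl <;> ext a b <;> fin_cases a <;>
      fin_cases b <;> simp [hX, rankOne_zero, rankOne_one, hp]
  rw [hsum]
  refine add_mem (add_mem (key 0 le_rfl _ ?_) (key 1 (by norm_num) _ ?_)) (key 2 (by norm_num) _ ?_)
  all_goals
    rw [mem_wSpace, mem_rSpace]
    refine ⟨⟨?_, ?_⟩, ?_⟩
    · rcases (by omega : i = 0 ∨ i = 1) with rfl | rfl <;>
        simp [hX, rankOne_zero, rankOne_one, Matrix.trace, Fin.sum_univ_four, hp] <;> ring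
    · rcases (by omega : i = 0 ∨ i = 1) with rfl | rfl
      · rw [Qmat_zero_mul_transpose_mul_Qdual]
        ext a b
        fin_cases a <;> fin_cases b <;> simp [hX, rankOne_zero, hp]
      · rw [Qmat_one_mul_transpose_mul_Qdual]
        ext a b
        fin_cases a <;> fin_cases b <;> simp [hX, rankOne_one, hp]
    · intro a b
      fin_cases a <;> fin_cases b <;> norm_num

/-- The functional `Y ↦ tr(XY)`. -/
noncomputable def traceMulLeft (X : M4) : M4 →ₗ[ℝ] ℝ :=
  Matrix.traceLinearMap (Fin 4) ℝ ℝ ∘ₗ LinearMap.mulLeft ℝ X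

lemma traceMulLeft_apply (X Y : M4) : traceMulLeft X Y = (X * Y).trace := rfl

lemma rUp_le_rSpace (i : Fin 2) (μ : ℤ) : rUp i μ ≤ rSpace i :=
  iSup₂_le fun _ _ => inf_le_left

lemma rUp_one_le_ker (i : Fin 2) (p : Fin 4 → ℝ) (hp : p 0 = 0) :
    rUp i 1 ≤ LinearMap.ker (traceMulLeft (rankOne i p)) := by
  refine iSup₂_le fun μ hμ Z hZ => ?_
  obtain ⟨hr, hw⟩ := mem_wSpace.1 hZ
  have hμ' : (1 : ℝ) ≤ μ := by exact_mod_cast hμ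
  have hzero (a b : Fin 4)
      (hab : (![1, 0, 0, -1] : Fin 4 → ℝ) a - (![1, 0, 0, -1] : Fin 4 → ℝ) b ≤ 0) :
      Z a b = 0 := by
    rcases mul_eq_zero.1 (hw a b) with h' | h'
    · linarith
    · exact h'
  have h11 := hzero 1 1 (by simp)
  have h12 := hzero 1 2 (by simp)
  have h21 := hzero 2 1 (by simp)
  have h22 := hzero 2 2 (by simp)
  have h31 := hzero 3 1 (by simp)
  have h32 := hzero 3 2 (by simp)
  have h00 := hzero 0 0 (by simp)
  have h33 := hzero 3 3 (by simp)
  have h10 := hzero 1 0 (by simp)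
  have h20 := hzero 2 0 (by simp)
  have h30 := hzero 3 0 (show (-1 - 1 : ℝ) ≤ 0 by norm_num)
  rw [LinearMap.mem_ker, traceMulLeft_apply]
  simp only [Matrix.trace, Matrix.diag_apply, Matrix.mul_apply, Fin.sum_univ_four]
  rcases (by omega : i = 0 ∨ i = 1) with rfl | rfl <;>
    simp [rankOne_zero, rankOne_one, hp, h11, h12, h21, h22, h31, h32, h00, h33, h10, h20, h30]

lemma rankOne_mem_map (i : Fin 2) (r s : ℝ) (p : Fin 4 → ℝ) (hp : uMat i r s 0 ⬝ᵥ p = 0) :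
    rankOne i p ∈ (rUp i 0).map (AdLin (uMat i r s)ᵀ) :=
  ⟨_, rankOne_mem_rUp_zero i _ hp, AdLin_rankOne i r s p⟩

lemma map_rUp_one_le_ker (i : Fin 2) (r s : ℝ) (p : Fin 4 → ℝ) (hp : uMat i r s 0 ⬝ᵥ p = 0) :
    (rUp i 1).map (AdLin (uMat i r s)ᵀ) ≤ LinearMap.ker (traceMulLeft (rankOne i p)) := by
  rintro _ ⟨Z, hZ, rfl⟩
  have hu := isUnit_det_transpose_uMat i r s
  have h := rUp_one_le_ker i (uMat i r s *ᵥ p) hp hZ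
  rw [LinearMap.mem_ker, traceMulLeft_apply] at h ⊢
  rw [← AdLin_rankOne i r s p, ← h]
  set X := rankOne i (uMat i r s *ᵥ p)
  change ((uMat i r s)ᵀ * X * (uMat i r s)ᵀ⁻¹ * ((uMat i r s)ᵀ * Z * (uMat i r s)ᵀ⁻¹)).trace = _
  rw [show (uMat i r s)ᵀ * X * (uMat i r s)ᵀ⁻¹ * ((uMat i r s)ᵀ * Z * (uMat i r s)ᵀ⁻¹)
    = (uMat i r s)ᵀ * X * ((uMat i r s)ᵀ⁻¹ * (uMat i r s)ᵀ) * Z * (uMat i r s)ᵀ⁻¹ by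
      simp only [Matrix.mul_assoc], Matrix.nonsing_inv_mul _ hu, Matrix.mul_one,
    Matrix.trace_mul_comm]
  simp only [← Matrix.mul_assoc]
  rw [Matrix.nonsing_inv_mul _ hu, Matrix.one_mul]

lemma map_rSpace_le (i : Fin 2) (r s : ℝ) :
    (rSpace i).map (AdLin (uMat i r s)ᵀ) ≤ rSpace i := by
  rintro _ ⟨Z, hZ, rfl⟩
  have hu := isUnit_det_transpose_uMat i r s
  obtain ⟨htr, hZ⟩ := mem_rSpace.1 hZ
  have hQ := transpose_uMat_mul_Qmat_mul i r s
  have hD := uMat_mul_Qdual_mul_transpose i r s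
  change (uMat i r s)ᵀ * Z * (uMat i r s)ᵀ⁻¹ ∈ _
  set g := (uMat i r s)ᵀ with hg
  have hg' : uMat i r s = gᵀ := by simp [hg]
  rw [hg'] at hD
  rw [mem_rSpace]
  constructor
  · rw [Matrix.trace_mul_comm, ← Matrix.mul_assoc, Matrix.nonsing_inv_mul _ hu, Matrix.one_mul, htr]
  · have h1 : Qmat i * g⁻¹ᵀ = g * Qmat i := by
      conv_lhs => rw [← hQ]
      rw [hg', Matrix.mul_assoc, ← Matrix.transpose_mul, Matrix.nonsing_inv_mul _ hu,
        Matrix.transpose_one, Matrix.mul_one]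
    have h2 : gᵀ * Qdual i = Qdual i * g⁻¹ := by
      conv_rhs => rw [← hD]
      rw [Matrix.mul_assoc _ g, Matrix.mul_nonsing_inv _ hu, Matrix.mul_one]
    rw [Matrix.transpose_mul, Matrix.transpose_mul]
    calc _ = g * (Qmat i * Zᵀ * Qdual i) * g⁻¹ := by rw [← hZ]
      _ = (g * Qmat i) * Zᵀ * (Qdual i * g⁻¹) := by simp only [Matrix.mul_assoc]
      _ = _ := by rw [← h1, ← h2]; simp only [Matrix.mul_assoc]

lemma finrank_rSpace_le (i : Fin 2) : Module.finrank ℝ (rSpace i) ≤ 9 := by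
  let idx : Fin 9 → Fin 4 × Fin 4 :=
    ![(0, 0), (0, 1), (0, 2), (0, 3), (1, 0), (2, 0), (3, 0), (1, 2),
      if i = 0 then (2, 1) else (1, 1)]
  let L : M4 →ₗ[ℝ] (Fin 9 → ℝ) :=
    LinearMap.pi fun k => Matrix.entryLinearMap ℝ ℝ (idx k).1 (idx k).2
  have hL : Function.Injective (L ∘ₗ (rSpace i).subtype) := by
    rw [← LinearMap.ker_eq_bot, LinearMap.ker_eq_bot']
    rintro ⟨Y, hY⟩ h0
    obtain ⟨htr, hQ⟩ := mem_rSpace.1 hY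
    have hk (k : Fin 9) : Y (idx k).1 (idx k).2 = 0 := congrFun h0 k
    have e0 := hk 0
    have e1 := hk 1
    have e2 := hk 2
    have e3 := hk 3
    have e4 := hk 4
    have e5 := hk 5
    have e6 := hk 6
    have e7 := hk 7
    have e8 := hk 8
    rw [Submodule.mk_eq_zero]
    clear h0 hk L
    rcases (by omega : i = 0 ∨ i = 1) with rfl | rfl
    · rw [Qmat_zero_mul_transpose_mul_Qdual] at hQ
      have q (a b : Fin 4) := congrFun (congrFun hQ a) b
      have q33 := q 3 3
      have q13 := q 1 3
      have q23 := q 2 3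
      have q31 := q 3 1
      have q32 := q 3 2
      have q22 := q 2 2
      simp [idx, Matrix.trace, Fin.sum_univ_four]
        at e0 e1 e2 e3 e4 e5 e6 e7 e8 htr q33 q13 q23 q31 q32 q22
      ext a b
      fin_cases a <;> fin_cases b <;> simp <;> linarith
    · rw [Qmat_one_mul_transpose_mul_Qdual] at hQ
      have q (a b : Fin 4) := congrFun (congrFun hQ a) b
      have q33 := q 3 3
      have q13 := q 1 3
      have q23 := q 2 3
      have q31 := q 3 1
      have q32 := q 3 2
      have q21 := q 2 1
      simp [idx, Matrix.trace, Fin.sum_univ_four]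
        at e0 e1 e2 e3 e4 e5 e6 e7 e8 htr q33 q13 q23 q31 q32 q21
      ext a b
      fin_cases a <;> fin_cases b <;> simp <;> linarith
  have h := LinearMap.finrank_le_finrank_of_injective hL
  rwa [Module.finrank_fin_fun] at h

lemma exists_mem_rSpace_trace_ne_zero (i : Fin 2) (p : Fin 4 → ℝ) (hp : p ≠ 0) :
    ∃ Y ∈ rSpace i, (rankOne i p * Y).trace ≠ 0 := by
  by_contra! h
  have h' (q : Fin 4 → ℝ) := h _ (rankOne_mem_rSpace i q)
  simp only [Matrix.trace, Matrix.diag_apply, Matrix.mul_apply, Fin.sum_univ_four] at h'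
  apply hp
  have h0 := h' ![1, 0, 0, 0]
  have h1 := h' ![0, 1, 0, 0]
  have h2 := h' ![0, 0, 1, 0]
  have h3 := h' ![0, 0, 0, 1]
  have hpp := h' p
  rcases (by omega : i = 0 ∨ i = 1) with rfl | rfl
  · simp [rankOne_zero] at h0 h1 h2 h3
    ext a
    fin_cases a <;> simp [*]
  · simp [rankOne_one] at h0 h3
    simp [rankOne_one, h0, h3] at hpp
    have hs : p 1 ^ 2 + p 2 ^ 2 = 0 := by
      refine pow_eq_zero_iff two_ne_zero |>.1 ?_
      linear_combination (4 / 3) * hpp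
    have hp1 : p 1 = 0 := pow_eq_zero_iff two_ne_zero |>.1
      (by linarith [sq_nonneg (p 1), sq_nonneg (p 2)])
    have hp2 : p 2 = 0 := pow_eq_zero_iff two_ne_zero |>.1
      (by linarith [sq_nonneg (p 1), sq_nonneg (p 2)])
    ext a
    fin_cases a <;> simp [h0, h3, hp1, hp2]

lemma exists_ne_zero_forall_dotProduct_eq_zero (v : Fin 3 → Fin 4 → ℝ) :
    ∃ p : Fin 4 → ℝ, p ≠ 0 ∧ ∀ k, v k ⬝ᵥ p = 0 := by
  obtain ⟨p, h, hp⟩ := (Submodule.ne_bot_iff _).1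
    (LinearMap.ker_ne_bot_of_finrank_lt (f := Matrix.mulVecLin (Matrix.of v)) (by simp))
  exact ⟨p, hp, fun k => congrFun (LinearMap.mem_ker.1 h) k⟩

/-- universal bounds: three copies of 𝔯ᵢ^{(1)} span ≤ 8 dimensions, three
copies of 𝔯ᵢ^{(0)} intersect in ≥ 1 dimension. -/
theorem stmt12 (i : Fin 2) (r₁ s₁ r₂ s₂ r₃ s₃ : ℝ) :
    Module.finrank ℝ
        ↥(Submodule.map (AdLin (uMat i r₁ s₁)ᵀ) (rUp i 1) ⊔
          Submodule.map (AdLin (uMat i r₂ s₂)ᵀ) (rUp i 1) ⊔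
          Submodule.map (AdLin (uMat i r₃ s₃)ᵀ) (rUp i 1)) ≤ 8 ∧
    1 ≤ Module.finrank ℝ
        ↥(Submodule.map (AdLin (uMat i r₁ s₁)ᵀ) (rUp i 0) ⊓
          Submodule.map (AdLin (uMat i r₂ s₂)ᵀ) (rUp i 0) ⊓
          Submodule.map (AdLin (uMat i r₃ s₃)ᵀ) (rUp i 0)) := by
  obtain ⟨p, hp0, hp⟩ := exists_ne_zero_forall_dotProduct_eq_zero
    ![uMat i r₁ s₁ 0, uMat i r₂ s₂ 0, uMat i r₃ s₃ 0]
  have hp₁ : uMat i r₁ s₁ 0 ⬝ᵥ p = 0 := hp 0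
  have hp₂ : uMat i r₂ s₂ 0 ⬝ᵥ p = 0 := hp 1
  have hp₃ : uMat i r₃ s₃ 0 ⬝ᵥ p = 0 := hp 2
  obtain ⟨Y, hY, hne⟩ := exists_mem_rSpace_trace_ne_zero i p hp0
  constructor
  · have hr (r s : ℝ) : (rUp i 1).map (AdLin (uMat i r s)ᵀ) ≤ rSpace i :=
      (Submodule.map_mono (rUp_le_rSpace i 1)).trans (map_rSpace_le i r s)
    have hlt := Submodule.finrank_lt_finrank_of_lt (lt_of_le_of_ne
      (sup_le (sup_le (hr r₁ s₁) (hr r₂ s₂)) (hr r₃ s₃)) fun heq => hne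
        (sup_le (sup_le (map_rUp_one_le_ker i r₁ s₁ p hp₁) (map_rUp_one_le_ker i r₂ s₂ p hp₂))
          (map_rUp_one_le_ker i r₃ s₃ p hp₃) (heq ▸ hY)))
    have := finrank_rSpace_le i
    omega
  · rw [Submodule.one_le_finrank_iff, Submodule.ne_bot_iff]
    exact ⟨rankOne i p, ⟨⟨rankOne_mem_map i r₁ s₁ p hp₁, rankOne_mem_map i r₂ s₂ p hp₂⟩,
      rankOne_mem_map i r₃ s₃ p hp₃⟩, fun h => hne (by simp [h])⟩
end

section
/- Fix i ∈ {1,2}. There exist constants κ > 0 (depending only on the dimensions 2 of the parameter space and 9 of 𝔯ᵢ) and C₀, E ≥ 1 such that the following holds: for every v ∈ 𝔯ᵢ with ‖v‖₂ = 1 and π^{(2)}(v) ≠ 0, every 8-dimensional subspace W ⊂ 𝔯ᵢ, and every ρ > 0, m_U({(r,s) ∈ [−1,1]² : d∠(Ad((u^{(i)}_{r,s})ᵀ)(ℝv), W) ≤ ρ}) ≤ C₀·‖π^{(2)}(v)‖₂^{−E}·ρ^κ. -/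
open Matrix MeasureTheory
open scoped Classical

theorem Polynomial.volume_abs_eval_le (d : ℕ) :
    ∃ C κ : ℝ, 4 ≤ C ∧ 0 < κ ∧ κ ≤ 1 ∧ ∀ (p : Polynomial ℝ) (k : ℕ) (δ ε : ℝ),
      p.natDegree ≤ d → 0 < δ → 0 < ε → δ ≤ |p.coeff k| →
      volume {t ∈ Set.Icc (-1 : ℝ) 1 | |p.eval t| ≤ ε} ≤ ENNReal.ofReal (C * (ε / δ) ^ κ) := by
  have hvol : ∀ P : ℝ → Prop, volume {t ∈ Set.Icc (-1 : ℝ) 1 | P t} ≤ ENNReal.ofReal 2 := by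
    intro P
    refine (measure_mono (Set.sep_subset _ _)).trans ?_
    rw [Real.volume_Icc]; norm_num
  induction d with
  | zero =>
    refine ⟨4, 1, le_rfl, one_pos, le_rfl, fun p k δ ε hp hδ hε hk => ?_⟩
    have hpc := Polynomial.eq_C_of_natDegree_le_zero hp
    by_cases h : δ ≤ ε
    · refine (hvol _).trans (ENNReal.ofReal_le_ofReal ?_)
      have : 1 ≤ ε / δ := (one_le_div hδ).2 h
      rw [Real.rpow_one]; linarith
    · have hempty : {t ∈ Set.Icc (-1 : ℝ) 1 | |p.eval t| ≤ ε} = ∅ := by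
        ext t
        simp only [Set.mem_ofPred_eq, Set.mem_empty_iff_false, iff_false, not_and, not_le]
        intro _
        rw [hpc] at hk ⊢
        rw [Polynomial.coeff_C] at hk
        rw [Polynomial.eval_C]
        split_ifs at hk
        · linarith
        · simp at hk; linarith
      rw [hempty]; simp
  | succ d ih =>
    obtain ⟨C, κ, hC, hκ, hκ1, H⟩ := ih
    refine ⟨2 + 8 * C, κ / 2, by linarith, by linarith, by linarith,
      fun p k δ ε hp hδ hε hk => ?_⟩
    set x := ε / δ with hx
    have hx0 : 0 < x := div_pos hε hδ
    by_cases h : 1 / 2 ≤ x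
    · refine (hvol _).trans (ENNReal.ofReal_le_ofReal ?_)
      have h1 : (1 / 2 : ℝ) ≤ (1 / 2 : ℝ) ^ (κ / 2) := by
        conv_lhs => rw [← Real.rpow_one (1 / 2 : ℝ)]
        exact Real.rpow_le_rpow_of_exponent_ge (by norm_num) (by norm_num) (by linarith)
      have h2 : (1 / 2 : ℝ) ^ (κ / 2) ≤ x ^ (κ / 2) :=
        Real.rpow_le_rpow (by norm_num) h (by linarith)
      nlinarith
    push Not at h
    rcases Set.eq_empty_or_nonempty {t ∈ Set.Icc (-1 : ℝ) 1 | |p.eval t| ≤ ε} with he | ⟨a, ha, hae⟩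
    · rw [he]; simp
    obtain ⟨q, hq⟩ := Polynomial.X_sub_C_dvd_sub_C_eval (a := a) (p := p)
    have hpq : p = Polynomial.C (p.eval a) + (Polynomial.X - Polynomial.C a) * q := by
      rw [← hq]; ring
    have hqd : q.natDegree ≤ d := by
      rcases eq_or_ne q 0 with rfl | hq0
      · simp
      have h1 := congrArg Polynomial.natDegree hq
      rw [Polynomial.natDegree_sub_C, (Polynomial.monic_X_sub_C a).natDegree_mul' hq0,
        Polynomial.natDegree_X_sub_C] at h1
      omega
    have hδε : ε < δ / 2 := by
      rw [hx, div_lt_iff₀ hδ] at h; linarith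
    have ha1 : |a| ≤ 1 := abs_le.2 ha
    have hj : ∃ j, δ / 4 ≤ |q.coeff j| := by
      by_contra! hcon
      have hmul : ∀ j, |a * q.coeff j| < δ / 4 := fun j => by
        rw [abs_mul]
        nlinarith [hcon j, abs_nonneg (q.coeff j), abs_nonneg a]
      rw [hpq] at hk
      rcases k with _ | k
      · simp only [Polynomial.coeff_add, Polynomial.coeff_C_zero, sub_mul, Polynomial.coeff_sub,
          Polynomial.coeff_X_mul_zero, Polynomial.coeff_C_mul] at hk
        have := abs_sub (p.eval a) (a * q.coeff 0)
        have := hmul 0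
        rw [zero_sub, ← sub_eq_add_neg] at hk
        linarith
      · simp only [Polynomial.coeff_add, Polynomial.coeff_C_succ, sub_mul, Polynomial.coeff_sub,
          Polynomial.coeff_X_mul, Polynomial.coeff_C_mul, zero_add] at hk
        have := abs_sub (q.coeff k) (a * q.coeff (k + 1))
        have := hmul (k + 1)
        have := hcon k
        linarith
    obtain ⟨j, hj⟩ := hj
    set η := Real.sqrt x with hη
    have hη0 : 0 < η := Real.sqrt_pos.2 hx0
    have hsub : {t ∈ Set.Icc (-1 : ℝ) 1 | |p.eval t| ≤ ε} ⊆
        Set.Icc (a - η) (a + η) ∪ {t ∈ Set.Icc (-1 : ℝ) 1 | |q.eval t| ≤ 2 * ε / η} := by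
      rintro t ⟨ht, hte⟩
      by_cases hta : |t - a| ≤ η
      · left
        rw [abs_le] at hta
        constructor <;> linarith
      · right
        push Not at hta
        refine ⟨ht, ?_⟩
        have h1 : (t - a) * q.eval t = p.eval t - p.eval a := by
          have := congrArg (Polynomial.eval t) hq
          simpa using this.symm
        have h2 : |t - a| * |q.eval t| ≤ 2 * ε := by
          rw [← abs_mul, h1]
          exact (abs_sub _ _).trans (by linarith)
        rw [le_div_iff₀ hη0]
        nlinarith [abs_nonneg (q.eval t)]
    have hH := H q j (δ / 4) (2 * ε / η) hqd (by linarith) (by positivity) hj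
    have hxη : 2 * ε / η / (δ / 4) = 8 * η := by
      have : ε = η * η * δ := by
        rw [hη, Real.mul_self_sqrt hx0.le, hx]; field_simp
      rw [this]; field_simp; norm_num
    rw [hxη] at hH
    refine (measure_mono hsub).trans ((measure_union_le _ _).trans ?_)
    rw [Real.volume_Icc]
    refine (add_le_add_right hH _).trans ?_
    rw [← ENNReal.ofReal_add (by linarith) (by positivity)]
    refine ENNReal.ofReal_le_ofReal ?_
    have hη1 : η ≤ 1 := by
      exact Real.sqrt_le_one.2 (by linarith)
    have h3 : η ^ κ = x ^ (κ / 2) := by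
      rw [hη, Real.sqrt_eq_rpow, ← Real.rpow_mul hx0.le]; congr 1; ring
    have h4 : η ≤ η ^ κ := by
      conv_lhs => rw [← Real.rpow_one η]
      exact Real.rpow_le_rpow_of_exponent_ge hη0 hη1 hκ1
    have h5 : (8 * η) ^ κ ≤ 8 * η ^ κ := by
      rw [Real.mul_rpow (by norm_num) hη0.le]
      have : (8 : ℝ) ^ κ ≤ 8 := by
        conv_rhs => rw [← Real.rpow_one (8 : ℝ)]
        exact Real.rpow_le_rpow_of_exponent_le (by norm_num) hκ1
      have := Real.rpow_nonneg hη0.le κ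
      nlinarith
    rw [← h3]
    nlinarith

theorem volume_abs_bivariate_le (d : ℕ) :
    ∃ C κ : ℝ, 1 ≤ C ∧ 0 < κ ∧ κ ≤ 1 ∧
      ∀ (c : Fin (d + 1) → Fin (d + 1) → ℝ) (j k : Fin (d + 1)) (δ ε : ℝ),
        0 < δ → 0 < ε → δ ≤ |c j k| →
        volume {p ∈ Set.Icc (-1 : ℝ) 1 ×ˢ Set.Icc (-1 : ℝ) 1 |
            |∑ a, ∑ b, c a b * p.1 ^ (a : ℕ) * p.2 ^ (b : ℕ)| ≤ ε} ≤
          ENNReal.ofReal (C * (ε / δ) ^ κ) := by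
  obtain ⟨C, κ, hC, hκ, hκ1, H⟩ := Polynomial.volume_abs_eval_le d
  have key : ∀ (e : Fin (d + 1) → ℝ) (j : Fin (d + 1)) (δ ε : ℝ),
      0 < δ → 0 < ε → δ ≤ |e j| →
      volume {t ∈ Set.Icc (-1 : ℝ) 1 | |∑ a, e a * t ^ (a : ℕ)| ≤ ε} ≤
        ENNReal.ofReal (C * (ε / δ) ^ κ) := by
    intro e j δ ε hδ hε hj
    have := H (∑ a : Fin (d + 1), Polynomial.monomial (a : ℕ) (e a)) j δ ε ?_ hδ hε ?_
    · simpa [Polynomial.eval_finsetSum] using this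
    · refine Polynomial.natDegree_sum_le_of_forall_le _ _ fun a _ => ?_
      exact (Polynomial.natDegree_monomial_le _).trans (by omega)
    · simpa [Polynomial.finsetSum_coeff, Polynomial.coeff_monomial, Fin.val_inj] using hj
  refine ⟨4 * C, κ / 2, by linarith, by linarith, by linarith,
    fun c j k δ ε hδ hε hjk => ?_⟩
  set x := ε / δ with hx
  have hx0 : 0 < x := div_pos hε hδ
  set η := Real.sqrt x with hη
  have hη0 : 0 < η := Real.sqrt_pos.2 hx0
  have hηη : ε = η * η * δ := by
    rw [hη, Real.mul_self_sqrt hx0.le, hx]; field_simp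
  have h3 : η ^ κ = x ^ (κ / 2) := by
    rw [hη, Real.sqrt_eq_rpow, ← Real.rpow_mul hx0.le]; congr 1; ring
  set S := {p ∈ Set.Icc (-1 : ℝ) 1 ×ˢ Set.Icc (-1 : ℝ) 1 |
            |∑ a, ∑ b, c a b * p.1 ^ (a : ℕ) * p.2 ^ (b : ℕ)| ≤ ε} with hS
  set B := {t ∈ Set.Icc (-1 : ℝ) 1 | |∑ b, c j b * t ^ (b : ℕ)| ≤ η * δ} with hB
  have hSm : MeasurableSet S := by
    have : MeasurableSet {p : ℝ × ℝ |
        |∑ a, ∑ b, c a b * p.1 ^ (a : ℕ) * p.2 ^ (b : ℕ)| ≤ ε} :=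
      measurableSet_le (by fun_prop) measurable_const
    exact (measurableSet_Icc.prod measurableSet_Icc).inter this
  have hBm : MeasurableSet B := by
    have : MeasurableSet {t : ℝ | |∑ b, c j b * t ^ (b : ℕ)| ≤ η * δ} :=
      measurableSet_le (by fun_prop) measurable_const
    exact measurableSet_Icc.inter this
  have hBv : volume B ≤ ENNReal.ofReal (C * η ^ κ) := by
    have := key (c j) k δ (η * δ) hδ (by positivity) hjk
    rwa [mul_div_cancel_right₀ _ hδ.ne'] at this
  have hsub : S ⊆ (Set.Icc (-1 : ℝ) 1 ×ˢ B) ∪ (S \ (Set.univ ×ˢ B)) := by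
    intro p hp
    by_cases hpB : p.2 ∈ B
    · exact Or.inl ⟨hp.1.1, hpB⟩
    · exact Or.inr ⟨hp, fun h => hpB h.2⟩
  have h1 : volume (Set.Icc (-1 : ℝ) 1 ×ˢ B) ≤ ENNReal.ofReal (2 * (C * η ^ κ)) := by
    rw [Measure.volume_eq_prod, Measure.prod_prod, Real.volume_Icc,
      ENNReal.ofReal_mul (by norm_num)]
    norm_num
    gcongr
  have h2 : volume (S \ (Set.univ ×ˢ B)) ≤ ENNReal.ofReal (2 * (C * η ^ κ)) := by
    rw [Measure.volume_eq_prod, Measure.prod_apply_symm (hSm.diff (MeasurableSet.univ.prod hBm))]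
    have hle : ∀ s : ℝ, volume ((fun r => (r, s)) ⁻¹' (S \ (Set.univ ×ˢ B))) ≤
        (Set.Icc (-1 : ℝ) 1).indicator (fun _ => ENNReal.ofReal (C * η ^ κ)) s := by
      intro s
      by_cases hs : s ∈ Set.Icc (-1 : ℝ) 1 ∧ s ∉ B
      · rw [Set.indicator_of_mem hs.1]
        have hlt : η * δ ≤ |∑ b, c j b * s ^ (b : ℕ)| := by
          by_contra! hcon
          exact hs.2 ⟨hs.1, hcon.le⟩
        have := key (fun a => ∑ b, c a b * s ^ (b : ℕ)) j (η * δ) ε (by positivity) hε hlt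
        have hη' : ε / (η * δ) = η := by rw [hηη]; field_simp
        rw [hη'] at this
        refine (measure_mono ?_).trans this
        rintro r ⟨⟨hr, hr'⟩, -⟩
        refine ⟨hr.1, ?_⟩
        convert hr' using 4
        rw [Finset.sum_mul]
        exact Finset.sum_congr rfl fun b _ => by ring
      · have : (fun r => (r, s)) ⁻¹' (S \ (Set.univ ×ˢ B)) = ∅ := by
          ext r
          simp only [Set.mem_preimage, Set.mem_empty_iff_false, iff_false]
          rintro ⟨hr, hr'⟩
          exact hs ⟨hr.1.2, fun h => hr' ⟨trivial, h⟩⟩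
        rw [this]; simp
    refine (lintegral_mono hle).trans ?_
    rw [lintegral_indicator measurableSet_Icc, setLIntegral_const, Real.volume_Icc,
      show (1 : ℝ) - -1 = 2 by norm_num, mul_comm, ← ENNReal.ofReal_mul (by norm_num)]
  refine (measure_mono hsub).trans ((measure_union_le _ _).trans ((add_le_add h1 h2).trans ?_))
  rw [← ENNReal.ofReal_add (by positivity) (by positivity), ← h3]
  exact ENNReal.ofReal_le_ofReal (by linarith)

theorem tinner_eq_sum (X Y : M4) : tinner X Y = ∑ p, ∑ q, X p q * Y p q := by
  simp [tinner, Matrix.trace, Matrix.mul_apply]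

theorem tinner_eq_sum_prod (X Y : M4) :
    tinner X Y = ∑ p : Fin 4 × Fin 4, X p.1 p.2 * Y p.1 p.2 := by
  rw [tinner_eq_sum, Fintype.sum_prod_type]

theorem tinner_comm (X Y : M4) : tinner X Y = tinner Y X := by
  simp [tinner_eq_sum, mul_comm]

/-- The trace inner product as a bilinear form. -/
def tinnerBilin : M4 →ₗ[ℝ] M4 →ₗ[ℝ] ℝ :=
  LinearMap.mk₂ ℝ tinner
    (by intro a b c; simp [tinner, add_mul])
    (by intro a b c; simp [tinner])
    (by intro a b c; simp [tinner, mul_add])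
    (by intro a b c; simp [tinner])

theorem tinnerBilin_apply (X Y : M4) : tinnerBilin X Y = tinner X Y := rfl

theorem tinner_self_nonneg (X : M4) : 0 ≤ tinner X X := by
  rw [tinner_eq_sum_prod]
  exact Finset.sum_nonneg fun p _ => mul_self_nonneg _

theorem tinner_self_eq_zero {X : M4} (h : tinner X X = 0) : X = 0 := by
  rw [tinner_eq_sum_prod, Finset.sum_eq_zero_iff_of_nonneg fun p _ => mul_self_nonneg _] at h
  ext p q
  exact mul_self_eq_zero.1 (h (p, q) (Finset.mem_univ _))

theorem tinner_sq_le (X Y : M4) : tinner X Y ^ 2 ≤ tinner X X * tinner Y Y := by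
  simp only [tinner_eq_sum_prod]
  refine (Finset.sum_mul_sq_le_sq_mul_sq _ _ _).trans_eq ?_
  simp only [sq]

theorem abs_entry_le_one {X : M4} (h : tinner X X = 1) (p q : Fin 4) : |X p q| ≤ 1 := by
  rw [← sq_le_one_iff_abs_le_one, ← h, tinner_eq_sum_prod, sq]
  exact Finset.single_le_sum (f := fun p : Fin 4 × Fin 4 => X p.1 p.2 * X p.1 p.2)
    (fun p _ => mul_self_nonneg _) (Finset.mem_univ (p, q))

theorem abs_mul_entry_le {A B : M4} {a b : ℝ} (ha : ∀ p q, |A p q| ≤ a) (hb : ∀ p q, |B p q| ≤ b)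
    (p q : Fin 4) : |(A * B) p q| ≤ 4 * (a * b) := by
  rw [Matrix.mul_apply]
  refine (Finset.abs_sum_le_sum_abs _ _).trans
    ((Finset.sum_le_card_nsmul _ _ (a * b) fun k _ => ?_).trans_eq (by simp))
  rw [abs_mul]
  exact mul_le_mul (ha _ _) (hb _ _) (abs_nonneg _) ((abs_nonneg _).trans (ha p k))

theorem tinner_self_le_of_abs_entry_le {X : M4} {a : ℝ} (h : ∀ p q, |X p q| ≤ a) :
    tinner X X ≤ 16 * a ^ 2 := by
  rw [tinner_eq_sum_prod]
  refine (Finset.sum_le_card_nsmul _ _ (a ^ 2) fun p _ => ?_).trans_eq (by simp)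
  rw [← abs_mul_abs_self, sq]
  exact mul_self_le_mul_self (abs_nonneg _) (h _ _)

/-- Squared distance from `e` to the span of an orthonormal tuple, bounded below through a
unit vector orthogonal to that span. -/
theorem tinner_sq_le_det_gram {m : ℕ} {e n : M4} {b : Fin m → M4} (he : tinner e e = 1)
    (hb : ∀ k l, tinner (b k) (b l) = if k = l then 1 else 0) (hn : tinner n n = 1)
    (hbn : ∀ k, tinner (b k) n = 0) :
    tinner e n ^ 2 ≤ (gram (Sum.elim (fun _ : Fin 1 => e) b)).det := by
  have hdet : (gram (Sum.elim (fun _ : Fin 1 => e) b)).det = 1 - ∑ k, tinner e (b k) ^ 2 := by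
    have : gram (Sum.elim (fun _ : Fin 1 => e) b) =
        Matrix.fromBlocks (Matrix.of fun _ _ => 1) (Matrix.of fun _ k => tinner e (b k))
          (Matrix.of fun k _ => tinner e (b k)) 1 := by
      ext (p | p) (q | q)
      · simp [_root_.gram, he]
      · simp [_root_.gram]
      · simp [_root_.gram, tinner_comm]
      · simp [_root_.gram, hb, Matrix.one_apply]
    rw [this, Matrix.det_fromBlocks_one₂₂]
    simp [Matrix.mul_apply, sq]
  set w : M4 := e - ∑ k, tinner e (b k) • b k with hw
  have h1 : tinner w n = tinner e n := by
    simp only [← tinnerBilin_apply, hw, map_sub, map_sum, map_smul, LinearMap.sub_apply,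
      LinearMap.sum_apply, LinearMap.smul_apply] at hbn ⊢
    simp [hbn]
  have h2 : ∀ k, tinner w (b k) = 0 := by
    intro k
    simp only [← tinnerBilin_apply, hw, map_sub, map_sum, map_smul, LinearMap.sub_apply,
      LinearMap.sum_apply, LinearMap.smul_apply] at hb ⊢
    simp [hb]
  have h3 : tinner w w = 1 - ∑ k, tinner e (b k) ^ 2 := by
    have : tinner w w = tinner w e := by
      conv_lhs => rw [← tinnerBilin_apply]; arg 2; rw [hw]
      simp only [map_sub, map_sum, map_smul, tinnerBilin_apply, h2]
      simp
    rw [this, ← he]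
    simp only [← tinnerBilin_apply, hw, map_sub, map_sum, map_smul, LinearMap.sub_apply,
      LinearMap.sum_apply, LinearMap.smul_apply]
    congr 1
    refine Finset.sum_congr rfl fun k _ => ?_
    rw [tinnerBilin_apply (b k), tinner_comm (b k), tinnerBilin_apply, smul_eq_mul, sq]
  have := tinner_sq_le w n
  rwa [h1, h3, hn, mul_one, ← hdet] at this

/-- General element of `rSpace i`, in coordinates. -/
def rCoord (i : Fin 2) (x : Fin 9 → ℝ) : M4 :=
  if i = 0 then
    !![x 4, x 1, x 2, x 0; x 5, -x 4, x 3, -x 2; x 6, x 7, -x 4, -x 1; x 8, -x 6, -x 5, x 4]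
  else
    !![x 4, x 1, x 2, x 0; x 5, x 7, x 3, -x 1; x 6, x 3, -2 * x 4 - x 7, -x 2;
      x 8, -x 5, -x 6, x 4]

theorem Qmat_zero_inv : (Qmat 0)⁻¹ = !![0,0,0,-2; 0,0,2,0; 0,2,0,0; -2,0,0,0] := by
  refine Matrix.inv_eq_right_inv ?_
  ext p q
  fin_cases p <;> fin_cases q <;> simp [Qmat, Matrix.mul_apply, Fin.sum_univ_four]

theorem Qmat_one_inv : (Qmat 1)⁻¹ = !![0,0,0,-1; 0,1,0,0; 0,0,1,0; -1,0,0,0] := by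
  refine Matrix.inv_eq_right_inv ?_
  ext p q
  fin_cases p <;> fin_cases q <;> simp [Qmat, Matrix.mul_apply, Fin.sum_univ_four]

theorem mem_rSpace_iff {i : Fin 2} {X : M4} :
    X ∈ rSpace i ↔ X.trace = 0 ∧ Qmat i * Xᵀ * (Qmat i)⁻¹ = X := by
  have : X ∈ rSpace i ↔ X.trace = 0 ∧ -(Qmat i * Xᵀ * (Qmat i)⁻¹) + X = 0 := Iff.rfl
  rw [this, neg_add_eq_zero]

theorem rCoord_mem (i : Fin 2) (x : Fin 9 → ℝ) : rCoord i x ∈ rSpace i := by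
  rw [mem_rSpace_iff]
  fin_cases i
  · refine ⟨by simp [rCoord, Matrix.trace, Fin.sum_univ_four], ?_⟩
    simp only [Fin.zero_eta, Qmat_zero_inv]
    ext p q
    fin_cases p <;> fin_cases q <;>
      simp [rCoord, Qmat, Matrix.mul_apply, Matrix.vecMul, dotProduct, Fin.sum_univ_four] <;> ring
  · refine ⟨by simp [rCoord, Matrix.trace, Fin.sum_univ_four]; ring, ?_⟩
    simp only [Fin.mk_one, Qmat_one_inv]
    ext p q
    fin_cases p <;> fin_cases q <;>
      simp [rCoord, Qmat, Matrix.mul_apply, Matrix.vecMul, dotProduct, Fin.sum_univ_four]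

theorem exists_rCoord_eq {i : Fin 2} {X : M4} (h : X ∈ rSpace i) : ∃ x, X = rCoord i x := by
  rw [mem_rSpace_iff] at h
  obtain ⟨ht, hX⟩ := h
  have hpq := fun p q => congrFun (congrFun hX p) q
  simp only [Matrix.trace, Fin.sum_univ_four, Matrix.diag_apply] at ht
  fin_cases i
  · refine ⟨![X 0 3, X 0 1, X 0 2, X 1 2, X 0 0, X 1 0, X 2 0, X 2 1, X 3 0], ?_⟩
    simp only [Fin.zero_eta, Qmat_zero_inv] at hpq
    simp [Fin.forall_fin_succ, Qmat, Matrix.mul_apply, Matrix.vecMul, dotProduct,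
      Fin.sum_univ_four] at hpq
    ext p q
    fin_cases p <;> fin_cases q <;> simp [rCoord] <;> linarith
  · refine ⟨![X 0 3, X 0 1, X 0 2, X 1 2, X 0 0, X 1 0, X 2 0, X 1 1, X 3 0], ?_⟩
    simp only [Fin.mk_one, Qmat_one_inv] at hpq
    simp [Fin.forall_fin_succ, Qmat, Matrix.mul_apply, Matrix.vecMul, dotProduct,
      Fin.sum_univ_four] at hpq
    ext p q
    fin_cases p <;> fin_cases q <;> simp [rCoord] <;> linarith

theorem exists_entry_rCoord (i : Fin 2) (k : Fin 9) :
    ∃ p q : Fin 4, ∀ x, rCoord i x p q = x k := by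
  refine ⟨(![0, 0, 0, 1, 0, 1, 2, if i = 0 then 2 else 1, 3] : Fin 9 → Fin 4) k,
    (![3, 1, 2, 2, 0, 0, 0, 1, 0] : Fin 9 → Fin 4) k, fun x => ?_⟩
  fin_cases i <;> fin_cases k <;> simp [rCoord]

theorem rCoord_injective (i : Fin 2) : Function.Injective (rCoord i) := by
  intro x y hxy
  ext k
  obtain ⟨p, q, h⟩ := exists_entry_rCoord i k
  rw [← h x, ← h y, hxy]

theorem nine_le_finrank_rSpace (i : Fin 2) : 9 ≤ Module.finrank ℝ (rSpace i) := by
  let f : (Fin 9 → ℝ) →ₗ[ℝ] M4 :=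
    { toFun := rCoord i
      map_add' := fun x y => by
        ext p q
        fin_cases i <;> fin_cases p <;> fin_cases q <;> simp [rCoord] <;> ring
      map_smul' := fun c x => by
        ext p q
        fin_cases i <;> fin_cases p <;> fin_cases q <;> simp [rCoord] <;> ring }
  have hf : Function.Injective (f.codRestrict (rSpace i) (rCoord_mem i)) :=
    fun x y hxy => rCoord_injective i (congrArg Subtype.val hxy)
  simpa using LinearMap.finrank_le_finrank_of_injective hf

theorem exists_unit_normal {i : Fin 2} {W : Submodule ℝ M4} (hW : Module.finrank ℝ W = 8) :
    ∃ n ∈ rSpace i, tinner n n = 1 ∧ ∀ w ∈ W, tinner w n = 0 := by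
  let g : rSpace i →ₗ[ℝ] Module.Dual ℝ W :=
    (tinnerBilin.compl₂ W.subtype).comp (rSpace i).subtype
  have hker : LinearMap.ker g ≠ ⊥ := LinearMap.ker_ne_bot_of_finrank_lt (by
    rw [Subspace.dual_finrank_eq, hW]
    exact nine_le_finrank_rSpace i)
  obtain ⟨n, hn, hn0⟩ := Submodule.exists_mem_ne_zero_of_ne_bot hker
  have hpos : 0 < tinner (n : M4) n := lt_of_le_of_ne (tinner_self_nonneg _)
    fun h => hn0 (Subtype.ext (tinner_self_eq_zero h.symm))
  refine ⟨(Real.sqrt (tinner (n : M4) n))⁻¹ • (n : M4), Submodule.smul_mem _ _ n.2, ?_, ?_⟩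
  · simp only [← tinnerBilin_apply, map_smul, LinearMap.smul_apply, smul_eq_mul]
    simp only [tinnerBilin_apply]
    rw [← mul_assoc, ← mul_inv, Real.mul_self_sqrt hpos.le, inv_mul_cancel₀ hpos.ne']
  · intro w hw
    have : tinner (n : M4) w = 0 := by
      have := LinearMap.congr_fun (LinearMap.mem_ker.1 hn) ⟨w, hw⟩
      exact this
    rw [← tinnerBilin_apply, map_smul, tinnerBilin_apply, tinner_comm w, this, smul_zero]

theorem wSpace_apply_eq_zero {i : Fin 2} {μ : ℤ} (hμ : 2 ≤ μ) {X : M4} (hX : X ∈ wSpace i μ)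
    {p q : Fin 4} (hpq : (p, q) ≠ (0, 3)) : X p q = 0 := by
  have h : aWt * X - X * aWt - (μ : ℝ) • X = 0 := hX.2
  have h := congrFun (congrFun h p) q
  have hμ' : (2 : ℝ) ≤ μ := by exact_mod_cast hμ
  simp only [aWt, Matrix.sub_apply, Matrix.diagonal_mul, Matrix.mul_diagonal,
    Matrix.smul_apply, Matrix.zero_apply, smul_eq_mul] at h
  have h' : ((![1, 0, 0, -1] : Fin 4 → ℝ) p - (![1, 0, 0, -1] : Fin 4 → ℝ) q - μ) * X p q = 0 := by
    linear_combination h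
  refine (mul_eq_zero.1 h').resolve_left (ne_of_lt ?_)
  fin_cases p <;> fin_cases q <;> simp at hpq ⊢ <;> linarith

theorem rUp_two_apply_eq_zero {i : Fin 2} {X : M4} (hX : X ∈ rUp i 2) {p q : Fin 4}
    (hpq : (p, q) ≠ (0, 3)) : X p q = 0 := by
  have hle : rUp i 2 ≤ LinearMap.ker (Matrix.entryLinearMap ℝ ℝ p q) := by
    refine iSup₂_le fun μ hμ X hX => ?_
    exact wSpace_apply_eq_zero hμ hX hpq
  exact hle hX

theorem single_mem_rUp_two (i : Fin 2) : (Matrix.single 0 3 1 : M4) ∈ rUp i 2 := by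
  have h1 : (Matrix.single 0 3 1 : M4) = rCoord i ![1, 0, 0, 0, 0, 0, 0, 0, 0] := by
    ext p q
    fin_cases i <;> fin_cases p <;> fin_cases q <;> simp [rCoord, Matrix.single]
  have h2 : (Matrix.single 0 3 1 : M4) ∈ wSpace i 2 := by
    refine ⟨h1 ▸ rCoord_mem i _, ?_⟩
    change aWt * Matrix.single 0 3 1 - Matrix.single 0 3 1 * aWt - ((2 : ℤ) : ℝ) • _ = 0
    ext p q
    simp only [aWt, Matrix.sub_apply, Matrix.diagonal_mul, Matrix.mul_diagonal,
      Matrix.smul_apply, Matrix.zero_apply, smul_eq_mul]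
    fin_cases p <;> fin_cases q <;> (simp [Matrix.single]; try norm_num)
  exact Submodule.mem_iSup_of_mem 2 (Submodule.mem_iSup_of_mem le_rfl h2)

theorem tinner_single_right (X : M4) : tinner X (Matrix.single 0 3 1) = X 0 3 := by
  simp [tinner_eq_sum, Fin.sum_univ_four, Matrix.single]

theorem mnorm2_top_projection {i : Fin 2} {X Y : M4} (hY : Y ∈ rUp i 2)
    (h : ∀ Z ∈ rUp i 2, tinner (X - Y) Z = 0) : mnorm2 Y = |X 0 3| := by
  have h1 := h _ (single_mem_rUp_two i)
  rw [tinner_single_right, Matrix.sub_apply, sub_eq_zero] at h1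
  have h2 : tinner Y Y = X 0 3 ^ 2 := by
    rw [tinner_eq_sum_prod, Finset.sum_eq_single (0, 3), h1, sq]
    · intro p _ hp
      rw [rUp_two_apply_eq_zero hY hp, zero_mul]
    · simp
  rw [mnorm2, h2, Real.sqrt_sq_eq_abs]

/-- Coefficients of the polynomial `(r, s) ↦ ⟨Ad(uᵀ) v, n⟩` in terms of the coordinates `x` of `v`
and `y` of `n`. -/
noncomputable def rCoeff (i : Fin 2) (x y : Fin 9 → ℝ) : Matrix (Fin 5) (Fin 5) ℝ :=
  if i = 0 then
    !![x 0 * y 0 + 2 * x 1 * y 1 + 2 * x 2 * y 2 + x 3 * y 3 + 4 * x 4 * y 4 + 2 * x 5 * y 5 + 2 *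
        x 6 * y 6 + x 7 * y 7 + x 8 * y 8,
      -2 * x 0 * y 1 + 2 * x 1 * y 7 - 4 * x 2 * y 4 - 2 * x 3 * y 5 + 4 * x 4 * y 6 + 2 * x 5 * y
        8,
      -x 0 * y 7 - 2 * x 2 * y 6 - x 3 * y 8,
      0,
      0;
      -2 * x 0 * y 2 - 4 * x 1 * y 4 + 2 * x 2 * y 3 + 4 * x 4 * y 5 + 2 * x 6 * y 8 - 2 * x 7 * y
        6,
      4 * x 0 * y 4 - 4 * x 1 * y 6 - 4 * x 2 * y 5 + 4 * x 4 * y 8,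
      2 * x 0 * y 6 - 2 * x 2 * y 8,
      0,
      0;
      -x 0 * y 3 - 2 * x 1 * y 5 - x 7 * y 8,
      2 * x 0 * y 5 - 2 * x 1 * y 8,
      x 0 * y 8,
      0,
      0;
      0, 0, 0, 0, 0;
      0, 0, 0, 0, 0]
  else
    !![x 0 * y 0 + 2 * x 1 * y 1 + 2 * x 2 * y 2 + 2 * x 3 * y 3 + 6 * x 4 * y 4 + 2 * x 4 * y 7 +
        2 * x 5 * y 5 + 2 * x 6 * y 6 + 2 * x 7 * y 4 + 2 * x 7 * y 7 + x 8 * y 8,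
      -2 * x 0 * y 2 + 2 * x 1 * y 3 - 6 * x 2 * y 4 - 2 * x 2 * y 7 - 2 * x 3 * y 5 + 6 * x 4 * y
        6 + 2 * x 6 * y 8 + 2 * x 7 * y 6,
      3 * x 0 * y 4 + x 0 * y 7 - x 1 * y 5 - 3 * x 2 * y 6 + 3 * x 4 * y 8 + x 7 * y 8,
      x 0 * y 6 - x 2 * y 8,
      1 / 4 * x 0 * y 8;
      -2 * x 0 * y 1 - 2 * x 1 * y 4 + 2 * x 1 * y 7 + 2 * x 2 * y 3 - 2 * x 3 * y 6 + 2 * x 4 * y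
        5 + 2 * x 5 * y 8 - 2 * x 7 * y 5,
      -2 * x 0 * y 3 - 2 * x 1 * y 6 - 2 * x 2 * y 5 - 2 * x 3 * y 8,
      x 0 * y 5 - x 1 * y 8,
      0,
      0;
      x 0 * y 4 - x 0 * y 7 - 3 * x 1 * y 5 - x 2 * y 6 + x 4 * y 8 - x 7 * y 8,
      x 0 * y 6 - x 2 * y 8,
      1 / 2 * x 0 * y 8,
      0,
      0;
      x 0 * y 5 - x 1 * y 8,
      0,
      0,
      0,
      0;
      1 / 4 * x 0 * y 8,
      0,
      0,
      0,
      0]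

theorem abs_le_of_mul_of_abs_le_one {u z B : ℝ} (hu : |u| ≤ 1) (hz : |z| ≤ B) :
    -B ≤ u * z ∧ u * z ≤ B := by
  rw [← abs_le, abs_mul]
  nlinarith [abs_nonneg u, abs_nonneg z]

theorem abs_pow_mul_le_of_rCoeff_zero {x y : Fin 9 → ℝ} {D : ℝ} (hx : ∀ k, |x k| ≤ 1)
    (hD : ∀ a b, |rCoeff 0 x y a b| ≤ D) (k : Fin 9) : |x 0 ^ 5 * y k| ≤ 150 * D := by
  have hp : ∀ m : ℕ, |x 0 ^ m| ≤ 1 := fun m => by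
    rw [abs_pow]; exact pow_le_one₀ (abs_nonneg _) (hx 0)
  have hu : ∀ (j : Fin 9) (m : ℕ), |x j * x 0 ^ m| ≤ 1 := fun j m => by
    rw [abs_mul]; exact mul_le_one₀ (hx j) (abs_nonneg _) (hp m)
  have hD0 : 0 ≤ D := (abs_nonneg _).trans (hD 0 0)
  have h8 : |x 0 ^ 1 * y 8| ≤ 1 * D := by
    have c := hD 2 2
    simp [rCoeff, -abs_mul] at c
    obtain ⟨_, _⟩ := abs_le_of_mul_of_abs_le_one (hp 0) c
    clear c
    rw [abs_le]; constructor <;> linarith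
  have h5 : |x 0 ^ 2 * y 5| ≤ 2 * D := by
    have c := hD 2 1
    simp [rCoeff, -abs_mul] at c
    obtain ⟨_, _⟩ := abs_le_of_mul_of_abs_le_one (hp 1) c
    clear c
    obtain ⟨_, _⟩ := abs_le_of_mul_of_abs_le_one (hu 1 0) h8
    rw [abs_le]; constructor <;> linarith
  have h6 : |x 0 ^ 2 * y 6| ≤ 2 * D := by
    have c := hD 1 2
    simp [rCoeff, -abs_mul] at c
    obtain ⟨_, _⟩ := abs_le_of_mul_of_abs_le_one (hp 1) c
    clear c
    obtain ⟨_, _⟩ := abs_le_of_mul_of_abs_le_one (hu 2 0) h8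
    rw [abs_le]; constructor <;> linarith
  have h3 : |x 0 ^ 3 * y 3| ≤ 6 * D := by
    have c := hD 2 0
    simp [rCoeff, -abs_mul] at c
    obtain ⟨_, _⟩ := abs_le_of_mul_of_abs_le_one (hp 2) c
    clear c
    obtain ⟨_, _⟩ := abs_le_of_mul_of_abs_le_one (hu 1 0) h5
    obtain ⟨_, _⟩ := abs_le_of_mul_of_abs_le_one (hu 7 1) h8
    rw [abs_le]; constructor <;> linarith
  have h7 : |x 0 ^ 3 * y 7| ≤ 6 * D := by
    have c := hD 0 2
    simp [rCoeff, -abs_mul] at c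
    obtain ⟨_, _⟩ := abs_le_of_mul_of_abs_le_one (hp 2) c
    clear c
    obtain ⟨_, _⟩ := abs_le_of_mul_of_abs_le_one (hu 2 0) h6
    obtain ⟨_, _⟩ := abs_le_of_mul_of_abs_le_one (hu 3 1) h8
    rw [abs_le]; constructor <;> linarith
  have h4 : |x 0 ^ 3 * y 4| ≤ 6 * D := by
    have c := hD 1 1
    simp [rCoeff, -abs_mul] at c
    obtain ⟨_, _⟩ := abs_le_of_mul_of_abs_le_one (hp 2) c
    clear c
    obtain ⟨_, _⟩ := abs_le_of_mul_of_abs_le_one (hu 1 0) h6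
    obtain ⟨_, _⟩ := abs_le_of_mul_of_abs_le_one (hu 2 0) h5
    obtain ⟨_, _⟩ := abs_le_of_mul_of_abs_le_one (hu 4 1) h8
    rw [abs_le]; constructor <;> linarith
  have h1 : |x 0 ^ 4 * y 1| ≤ 26 * D := by
    have c := hD 0 1
    simp [rCoeff, -abs_mul] at c
    obtain ⟨_, _⟩ := abs_le_of_mul_of_abs_le_one (hp 3) c
    clear c
    obtain ⟨_, _⟩ := abs_le_of_mul_of_abs_le_one (hu 1 0) h7
    obtain ⟨_, _⟩ := abs_le_of_mul_of_abs_le_one (hu 2 0) h4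
    obtain ⟨_, _⟩ := abs_le_of_mul_of_abs_le_one (hu 3 1) h5
    obtain ⟨_, _⟩ := abs_le_of_mul_of_abs_le_one (hu 4 1) h6
    obtain ⟨_, _⟩ := abs_le_of_mul_of_abs_le_one (hu 5 2) h8
    rw [abs_le]; constructor <;> linarith
  have h2 : |x 0 ^ 4 * y 2| ≤ 26 * D := by
    have c := hD 1 0
    simp [rCoeff, -abs_mul] at c
    obtain ⟨_, _⟩ := abs_le_of_mul_of_abs_le_one (hp 3) c
    clear c
    obtain ⟨_, _⟩ := abs_le_of_mul_of_abs_le_one (hu 1 0) h4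
    obtain ⟨_, _⟩ := abs_le_of_mul_of_abs_le_one (hu 2 0) h3
    obtain ⟨_, _⟩ := abs_le_of_mul_of_abs_le_one (hu 4 1) h5
    obtain ⟨_, _⟩ := abs_le_of_mul_of_abs_le_one (hu 6 2) h8
    obtain ⟨_, _⟩ := abs_le_of_mul_of_abs_le_one (hu 7 1) h6
    rw [abs_le]; constructor <;> linarith
  have h0 : |x 0 ^ 5 * y 0| ≤ 150 * D := by
    have c := hD 0 0
    simp [rCoeff, -abs_mul] at c
    obtain ⟨_, _⟩ := abs_le_of_mul_of_abs_le_one (hp 4) c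
    clear c
    obtain ⟨_, _⟩ := abs_le_of_mul_of_abs_le_one (hu 1 0) h1
    obtain ⟨_, _⟩ := abs_le_of_mul_of_abs_le_one (hu 2 0) h2
    obtain ⟨_, _⟩ := abs_le_of_mul_of_abs_le_one (hu 3 1) h3
    obtain ⟨_, _⟩ := abs_le_of_mul_of_abs_le_one (hu 4 1) h4
    obtain ⟨_, _⟩ := abs_le_of_mul_of_abs_le_one (hu 5 2) h5
    obtain ⟨_, _⟩ := abs_le_of_mul_of_abs_le_one (hu 6 2) h6
    obtain ⟨_, _⟩ := abs_le_of_mul_of_abs_le_one (hu 7 1) h7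
    obtain ⟨_, _⟩ := abs_le_of_mul_of_abs_le_one (hu 8 3) h8
    rw [abs_le]; constructor <;> linarith
  fin_cases k
  · obtain ⟨_, _⟩ := abs_le_of_mul_of_abs_le_one (hp 0) h0
    change |x 0 ^ 5 * y 0| ≤ _
    rw [abs_le]; constructor <;> linarith
  · obtain ⟨_, _⟩ := abs_le_of_mul_of_abs_le_one (hp 1) h1
    change |x 0 ^ 5 * y 1| ≤ _
    rw [abs_le]; constructor <;> linarith
  · obtain ⟨_, _⟩ := abs_le_of_mul_of_abs_le_one (hp 1) h2
    change |x 0 ^ 5 * y 2| ≤ _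
    rw [abs_le]; constructor <;> linarith
  · obtain ⟨_, _⟩ := abs_le_of_mul_of_abs_le_one (hp 2) h3
    change |x 0 ^ 5 * y 3| ≤ _
    rw [abs_le]; constructor <;> linarith
  · obtain ⟨_, _⟩ := abs_le_of_mul_of_abs_le_one (hp 2) h4
    change |x 0 ^ 5 * y 4| ≤ _
    rw [abs_le]; constructor <;> linarith
  · obtain ⟨_, _⟩ := abs_le_of_mul_of_abs_le_one (hp 3) h5
    change |x 0 ^ 5 * y 5| ≤ _
    rw [abs_le]; constructor <;> linarith
  · obtain ⟨_, _⟩ := abs_le_of_mul_of_abs_le_one (hp 3) h6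
    change |x 0 ^ 5 * y 6| ≤ _
    rw [abs_le]; constructor <;> linarith
  · obtain ⟨_, _⟩ := abs_le_of_mul_of_abs_le_one (hp 2) h7
    change |x 0 ^ 5 * y 7| ≤ _
    rw [abs_le]; constructor <;> linarith
  · obtain ⟨_, _⟩ := abs_le_of_mul_of_abs_le_one (hp 4) h8
    change |x 0 ^ 5 * y 8| ≤ _
    rw [abs_le]; constructor <;> linarith

theorem abs_pow_mul_le_of_rCoeff_one {x y : Fin 9 → ℝ} {D : ℝ} (hx : ∀ k, |x k| ≤ 1)
    (hD : ∀ a b, |rCoeff 1 x y a b| ≤ D) (k : Fin 9) : |x 0 ^ 5 * y k| ≤ 657 * D := by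
  have hp : ∀ m : ℕ, |x 0 ^ m| ≤ 1 := fun m => by
    rw [abs_pow]; exact pow_le_one₀ (abs_nonneg _) (hx 0)
  have hu : ∀ (j : Fin 9) (m : ℕ), |x j * x 0 ^ m| ≤ 1 := fun j m => by
    rw [abs_mul]; exact mul_le_one₀ (hx j) (abs_nonneg _) (hp m)
  have hD0 : 0 ≤ D := (abs_nonneg _).trans (hD 0 0)
  have h8 : |x 0 ^ 1 * y 8| ≤ 2 * D := by
    have c := hD 2 2
    simp [rCoeff, -abs_mul] at c
    obtain ⟨_, _⟩ := abs_le_of_mul_of_abs_le_one (hp 0) c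
    clear c
    rw [abs_le]; constructor <;> linarith
  have h5 : |x 0 ^ 2 * y 5| ≤ 3 * D := by
    have c := hD 3 0
    simp [rCoeff, -abs_mul] at c
    obtain ⟨_, _⟩ := abs_le_of_mul_of_abs_le_one (hp 1) c
    clear c
    obtain ⟨_, _⟩ := abs_le_of_mul_of_abs_le_one (hu 1 0) h8
    rw [abs_le]; constructor <;> linarith
  have h6 : |x 0 ^ 2 * y 6| ≤ 3 * D := by
    have c := hD 2 1
    simp [rCoeff, -abs_mul] at c
    obtain ⟨_, _⟩ := abs_le_of_mul_of_abs_le_one (hp 1) c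
    clear c
    obtain ⟨_, _⟩ := abs_le_of_mul_of_abs_le_one (hu 2 0) h8
    rw [abs_le]; constructor <;> linarith
  have h3 : |x 0 ^ 3 * y 3| ≤ 9 * D := by
    have c := hD 1 1
    simp [rCoeff, -abs_mul] at c
    obtain ⟨_, _⟩ := abs_le_of_mul_of_abs_le_one (hp 2) c
    clear c
    obtain ⟨_, _⟩ := abs_le_of_mul_of_abs_le_one (hu 1 0) h6
    obtain ⟨_, _⟩ := abs_le_of_mul_of_abs_le_one (hu 2 0) h5
    obtain ⟨_, _⟩ := abs_le_of_mul_of_abs_le_one (hu 3 1) h8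
    rw [abs_le]; constructor <;> linarith
  have h4 : |x 0 ^ 3 * y 4| ≤ 9 * D := by
    have c := hD 2 0
    simp [rCoeff, -abs_mul] at c
    obtain ⟨_, _⟩ := abs_le_of_mul_of_abs_le_one (hp 2) c
    clear c
    have c := hD 0 2
    simp [rCoeff, -abs_mul] at c
    obtain ⟨_, _⟩ := abs_le_of_mul_of_abs_le_one (hp 2) c
    clear c
    obtain ⟨_, _⟩ := abs_le_of_mul_of_abs_le_one (hu 1 0) h5
    obtain ⟨_, _⟩ := abs_le_of_mul_of_abs_le_one (hu 2 0) h6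
    obtain ⟨_, _⟩ := abs_le_of_mul_of_abs_le_one (hu 4 1) h8
    rw [abs_le]; constructor <;> linarith
  have h7 : |x 0 ^ 3 * y 7| ≤ 48 * D := by
    have c := hD 0 2
    simp [rCoeff, -abs_mul] at c
    obtain ⟨_, _⟩ := abs_le_of_mul_of_abs_le_one (hp 2) c
    clear c
    obtain ⟨_, _⟩ := abs_le.1 h4
    obtain ⟨_, _⟩ := abs_le_of_mul_of_abs_le_one (hu 1 0) h5
    obtain ⟨_, _⟩ := abs_le_of_mul_of_abs_le_one (hu 2 0) h6
    obtain ⟨_, _⟩ := abs_le_of_mul_of_abs_le_one (hu 4 1) h8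
    obtain ⟨_, _⟩ := abs_le_of_mul_of_abs_le_one (hu 7 1) h8
    rw [abs_le]; constructor <;> linarith
  have h1 : |x 0 ^ 4 * y 1| ≤ 78 * D := by
    have c := hD 1 0
    simp [rCoeff, -abs_mul] at c
    obtain ⟨_, _⟩ := abs_le_of_mul_of_abs_le_one (hp 3) c
    clear c
    obtain ⟨_, _⟩ := abs_le_of_mul_of_abs_le_one (hu 1 0) h4
    obtain ⟨_, _⟩ := abs_le_of_mul_of_abs_le_one (hu 1 0) h7
    obtain ⟨_, _⟩ := abs_le_of_mul_of_abs_le_one (hu 2 0) h3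
    obtain ⟨_, _⟩ := abs_le_of_mul_of_abs_le_one (hu 3 1) h6
    obtain ⟨_, _⟩ := abs_le_of_mul_of_abs_le_one (hu 4 1) h5
    obtain ⟨_, _⟩ := abs_le_of_mul_of_abs_le_one (hu 5 2) h8
    obtain ⟨_, _⟩ := abs_le_of_mul_of_abs_le_one (hu 7 1) h5
    rw [abs_le]; constructor <;> linarith
  have h2 : |x 0 ^ 4 * y 2| ≤ 102 * D := by
    have c := hD 0 1
    simp [rCoeff, -abs_mul] at c
    obtain ⟨_, _⟩ := abs_le_of_mul_of_abs_le_one (hp 3) c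
    clear c
    obtain ⟨_, _⟩ := abs_le_of_mul_of_abs_le_one (hu 1 0) h3
    obtain ⟨_, _⟩ := abs_le_of_mul_of_abs_le_one (hu 2 0) h4
    obtain ⟨_, _⟩ := abs_le_of_mul_of_abs_le_one (hu 2 0) h7
    obtain ⟨_, _⟩ := abs_le_of_mul_of_abs_le_one (hu 3 1) h5
    obtain ⟨_, _⟩ := abs_le_of_mul_of_abs_le_one (hu 4 1) h6
    obtain ⟨_, _⟩ := abs_le_of_mul_of_abs_le_one (hu 6 2) h8
    obtain ⟨_, _⟩ := abs_le_of_mul_of_abs_le_one (hu 7 1) h6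
    rw [abs_le]; constructor <;> linarith
  have h0 : |x 0 ^ 5 * y 0| ≤ 657 * D := by
    have c := hD 0 0
    simp [rCoeff, -abs_mul] at c
    obtain ⟨_, _⟩ := abs_le_of_mul_of_abs_le_one (hp 4) c
    clear c
    obtain ⟨_, _⟩ := abs_le_of_mul_of_abs_le_one (hu 1 0) h1
    obtain ⟨_, _⟩ := abs_le_of_mul_of_abs_le_one (hu 2 0) h2
    obtain ⟨_, _⟩ := abs_le_of_mul_of_abs_le_one (hu 3 1) h3
    obtain ⟨_, _⟩ := abs_le_of_mul_of_abs_le_one (hu 4 1) h4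
    obtain ⟨_, _⟩ := abs_le_of_mul_of_abs_le_one (hu 4 1) h7
    obtain ⟨_, _⟩ := abs_le_of_mul_of_abs_le_one (hu 5 2) h5
    obtain ⟨_, _⟩ := abs_le_of_mul_of_abs_le_one (hu 6 2) h6
    obtain ⟨_, _⟩ := abs_le_of_mul_of_abs_le_one (hu 7 1) h4
    obtain ⟨_, _⟩ := abs_le_of_mul_of_abs_le_one (hu 7 1) h7
    obtain ⟨_, _⟩ := abs_le_of_mul_of_abs_le_one (hu 8 3) h8
    rw [abs_le]; constructor <;> linarith
  fin_cases k
  · obtain ⟨_, _⟩ := abs_le_of_mul_of_abs_le_one (hp 0) h0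
    change |x 0 ^ 5 * y 0| ≤ _
    rw [abs_le]; constructor <;> linarith
  · obtain ⟨_, _⟩ := abs_le_of_mul_of_abs_le_one (hp 1) h1
    change |x 0 ^ 5 * y 1| ≤ _
    rw [abs_le]; constructor <;> linarith
  · obtain ⟨_, _⟩ := abs_le_of_mul_of_abs_le_one (hp 1) h2
    change |x 0 ^ 5 * y 2| ≤ _
    rw [abs_le]; constructor <;> linarith
  · obtain ⟨_, _⟩ := abs_le_of_mul_of_abs_le_one (hp 2) h3
    change |x 0 ^ 5 * y 3| ≤ _
    rw [abs_le]; constructor <;> linarith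
  · obtain ⟨_, _⟩ := abs_le_of_mul_of_abs_le_one (hp 2) h4
    change |x 0 ^ 5 * y 4| ≤ _
    rw [abs_le]; constructor <;> linarith
  · obtain ⟨_, _⟩ := abs_le_of_mul_of_abs_le_one (hp 3) h5
    change |x 0 ^ 5 * y 5| ≤ _
    rw [abs_le]; constructor <;> linarith
  · obtain ⟨_, _⟩ := abs_le_of_mul_of_abs_le_one (hp 3) h6
    change |x 0 ^ 5 * y 6| ≤ _
    rw [abs_le]; constructor <;> linarith
  · obtain ⟨_, _⟩ := abs_le_of_mul_of_abs_le_one (hp 2) h7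
    change |x 0 ^ 5 * y 7| ≤ _
    rw [abs_le]; constructor <;> linarith
  · obtain ⟨_, _⟩ := abs_le_of_mul_of_abs_le_one (hp 4) h8
    change |x 0 ^ 5 * y 8| ≤ _
    rw [abs_le]; constructor <;> linarith

theorem uMat_transpose_inv (i : Fin 2) (r s : ℝ) :
    ((uMat i r s)ᵀ)⁻¹ = (uMat i (-r) (-s))ᵀ := by
  refine Matrix.inv_eq_right_inv ?_
  rw [← Matrix.transpose_mul, ← Matrix.transpose_one]
  congr 1
  ext p q
  fin_cases i <;> fin_cases p <;> fin_cases q <;>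
    simp [uMat, Matrix.mul_apply, Fin.sum_univ_four] <;> ring

set_option maxHeartbeats 1600000 in
theorem tinner_AdLin_rCoord (i : Fin 2) (x y : Fin 9 → ℝ) (r s : ℝ) :
    tinner (AdLin (uMat i r s)ᵀ (rCoord i x)) (rCoord i y) =
      ∑ a, ∑ b, rCoeff i x y a b * r ^ (a : ℕ) * s ^ (b : ℕ) := by
  have h : AdLin (uMat i r s)ᵀ (rCoord i x) =
      (uMat i r s)ᵀ * rCoord i x * (uMat i (-r) (-s))ᵀ := by
    rw [← uMat_transpose_inv]; rfl
  rw [h, tinner_eq_sum]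
  fin_cases i <;>
  · simp [Fin.sum_univ_four, Fin.sum_univ_five, Matrix.mul_apply, rCoord, uMat, rCoeff,
      Matrix.vecMul, dotProduct]
    ring

theorem abs_rCoord_apply_le {i : Fin 2} {y : Fin 9 → ℝ} {a B : ℝ} (h : ∀ k, |a * y k| ≤ B)
    (p q : Fin 4) : |a * rCoord i y p q| ≤ 3 * B := by
  have hB : 0 ≤ B := (abs_nonneg _).trans (h 0)
  have h' := fun k => abs_le.1 (h k)
  obtain ⟨_, _⟩ := h' 4
  obtain ⟨_, _⟩ := h' 7
  rw [abs_le]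
  fin_cases i <;> fin_cases p <;> fin_cases q <;> simp [rCoord] <;> constructor <;>
    linarith [h' 0, h' 1, h' 2, h' 3, h' 5, h' 6, h' 8]

/-- Non-degeneracy: some coefficient of `(r, s) ↦ ⟨Ad(uᵀ) v, n⟩` is bounded below in terms of the
top-weight coordinate of `v`. -/
theorem exists_le_abs_rCoeff {i : Fin 2} {x y : Fin 9 → ℝ} (hx : ∀ k, |x k| ≤ 1) (hx0 : x 0 ≠ 0)
    (hy : tinner (rCoord i y) (rCoord i y) = 1) :
    ∃ a b, |x 0| ^ 5 / 10000 ≤ |rCoeff i x y a b| := by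
  by_contra! hlt
  set D := |x 0| ^ 5 / 10000 with hD
  have hDpos : 0 < D := by positivity
  have hk : ∀ k, |x 0 ^ 5 * y k| ≤ 657 * D := by
    intro k
    fin_cases i
    · exact (abs_pow_mul_le_of_rCoeff_zero hx (fun a b => (hlt a b).le) k).trans (by linarith)
    · exact abs_pow_mul_le_of_rCoeff_one hx (fun a b => (hlt a b).le) k
  have h := tinner_self_le_of_abs_entry_le (X := (x 0 ^ 5) • rCoord i y)
    (fun p q => abs_rCoord_apply_le hk p q)
  rw [← tinnerBilin_apply, map_smul, map_smul, LinearMap.smul_apply, tinnerBilin_apply, hy,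
    smul_eq_mul, smul_eq_mul, mul_one, ← sq, ← sq_abs, abs_pow,
    show |x 0| ^ 5 = 10000 * D by rw [hD]; ring] at h
  nlinarith

theorem abs_uMat_transpose_apply_le {i : Fin 2} {r s : ℝ} (hr : |r| ≤ 1) (hs : |s| ≤ 1)
    (p q : Fin 4) : |(uMat i r s)ᵀ p q| ≤ 1 := by
  have h1 : |s * r| ≤ 1 := by rw [abs_mul]; exact mul_le_one₀ hs (abs_nonneg _) hr
  have h2 : |(r ^ 2 + s ^ 2) / 2| ≤ 1 := by
    have := sq_le_one_iff_abs_le_one r |>.2 hr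
    have := sq_le_one_iff_abs_le_one s |>.2 hs
    rw [abs_of_nonneg (by positivity)]
    linarith
  fin_cases i <;> fin_cases p <;> fin_cases q <;>
    simp [uMat, hr, hs, -abs_mul, h1, h2]

theorem tinner_AdLin_self_le {i : Fin 2} {r s : ℝ} (hr : |r| ≤ 1) (hs : |s| ≤ 1) {v : M4}
    (hv : tinner v v = 1) :
    tinner (AdLin (uMat i r s)ᵀ v) (AdLin (uMat i r s)ᵀ v) ≤ 64 ^ 2 := by
  have h : AdLin (uMat i r s)ᵀ v = (uMat i r s)ᵀ * v * (uMat i (-r) (-s))ᵀ := by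
    rw [← uMat_transpose_inv]; rfl
  rw [h]
  refine (tinner_self_le_of_abs_entry_le (abs_mul_entry_le (abs_mul_entry_le
    (abs_uMat_transpose_apply_le hr hs) (abs_entry_le_one hv))
    (abs_uMat_transpose_apply_le (by rwa [abs_neg]) (by rwa [abs_neg])))).trans ?_
  norm_num

/-- A line spanned by `w` that is `ρ`-close to a hyperplane with unit normal `n` satisfies
`|⟨w, n⟩| ≤ B ρ` whenever `‖w‖ ≤ B`. -/
theorem abs_tinner_le_of_det_gram_le {m : ℕ} {e n w : M4} {b : Fin m → M4} {W : Submodule ℝ M4}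
    {B ρ : ℝ} (hB : 0 ≤ B) (hρ : 0 ≤ ρ) (he : IsONB (fun _ : Fin 1 => e) (Submodule.span ℝ {w}))
    (hb : IsONB b W) (hn : tinner n n = 1) (hWn : ∀ z ∈ W, tinner z n = 0)
    (hw : tinner w w ≤ B ^ 2)
    (hdet : (gram (Sum.elim (fun _ : Fin 1 => e) b)).det ≤ ρ ^ 2) :
    |tinner w n| ≤ B * ρ := by
  have hee : tinner e e = 1 := by simpa using he.2.1 0 0
  have hw' : w ∈ Submodule.span ℝ {e} := by
    have := he.2.2
    rw [Set.range_const] at this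
    rw [this]
    exact Submodule.mem_span_singleton_self w
  obtain ⟨c, rfl⟩ := Submodule.mem_span_singleton.1 hw'
  have h := (tinner_sq_le_det_gram hee (fun k l => by convert hb.2.1 k l) hn fun k => hWn _ (hb.1 k)).trans hdet
  simp only [← tinnerBilin_apply, map_smul, LinearMap.smul_apply, smul_eq_mul] at hw hee h ⊢
  rw [hee, mul_one, ← sq] at hw
  rw [abs_mul]
  exact mul_le_mul (abs_le_of_sq_le_sq hw hB) (abs_le_of_sq_le_sq h hρ)
    (abs_nonneg _) hB

/-- non-degeneracy of the family of lines {Ad(uᵀ)ℝv}: polynomial decay of the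
measure of parameters where the line is close to a fixed hyperplane W ⊂ 𝔯ᵢ. -/
theorem stmt14 (i : Fin 2) :
    ∃ κ : ℝ, 0 < κ ∧
    ∃ C₀ E : ℝ, 1 ≤ C₀ ∧ 1 ≤ E ∧
    ∀ v : M4, v ∈ rSpace i → mnorm2 v = 1 →
    ∀ π : M4 → M4,
      (∀ X ∈ rSpace i, π X ∈ rUp i 2 ∧ ∀ Y ∈ rUp i 2, tinner (X - π X) Y = 0) →
      π v ≠ 0 →
    ∀ W : Submodule ℝ M4, W ≤ rSpace i → Module.finrank ℝ ↥W = 8 →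
    ∀ ρ : ℝ, 0 < ρ →
      mU {p ∈ uSq | ∃ (e : M4) (bW : Fin 8 → M4),
          IsONB (fun _ : Fin 1 => e)
            (Submodule.map (AdLin (uMat i p.1 p.2)ᵀ) (Submodule.span ℝ {v})) ∧
          IsONB bW W ∧
          (gram (Sum.elim (fun _ : Fin 1 => e) bW)).det ≤ ρ ^ 2}
        ≤ ENNReal.ofReal (C₀ * (mnorm2 (π v)) ^ (-E) * ρ ^ κ) := by
  obtain ⟨C, κ, hC, hκ, hκ1, hvol⟩ := volume_abs_bivariate_le 4
  refine ⟨κ, hκ, C * 640000, 5, by linarith, by norm_num, ?_⟩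
  intro v hv hv1 π hπ hπv W _ hW8 ρ hρ
  have hvv : tinner v v = 1 := Real.sqrt_eq_one.1 hv1
  obtain ⟨hπmem, hπorth⟩ := hπ v hv
  have hnorm := mnorm2_top_projection hπmem hπorth
  obtain ⟨n, hn, hnn, hWn⟩ := exists_unit_normal (i := i) hW8
  obtain ⟨x, rfl⟩ := exists_rCoord_eq hv
  obtain ⟨y, rfl⟩ := exists_rCoord_eq hn
  have hx : ∀ k, |x k| ≤ 1 := fun k => by
    obtain ⟨p, q, h⟩ := exists_entry_rCoord i k
    rw [← h x]
    exact abs_entry_le_one hvv p q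
  have htop : rCoord i x 0 3 = x 0 := by fin_cases i <;> rfl
  rw [htop] at hnorm
  have hx0 : x 0 ≠ 0 := fun h => hπv <| tinner_self_eq_zero <|
    (Real.sqrt_eq_zero (tinner_self_nonneg _)).1 (by rw [h, abs_zero] at hnorm; exact hnorm)
  obtain ⟨a, b, hab⟩ := exists_le_abs_rCoeff hx hx0 hnn
  have hpos : 0 < |x 0| := abs_pos.2 hx0
  have hsub : {p ∈ uSq | ∃ (e : M4) (bW : Fin 8 → M4),
      IsONB (fun _ : Fin 1 => e)
        (Submodule.map (AdLin (uMat i p.1 p.2)ᵀ) (Submodule.span ℝ {rCoord i x})) ∧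
      IsONB bW W ∧ (gram (Sum.elim (fun _ : Fin 1 => e) bW)).det ≤ ρ ^ 2} ⊆
      {p ∈ Set.Icc (-1 : ℝ) 1 ×ˢ Set.Icc (-1 : ℝ) 1 |
        |∑ a, ∑ b, rCoeff i x y a b * p.1 ^ (a : ℕ) * p.2 ^ (b : ℕ)| ≤ 64 * ρ} := by
    rintro ⟨r, s⟩ ⟨hp, e, bW, he, hbW, hdet⟩
    refine ⟨hp, ?_⟩
    rw [Submodule.map_span, Set.image_singleton] at he
    rw [← tinner_AdLin_rCoord]
    exact abs_tinner_le_of_det_gram_le (by norm_num) hρ.le he hbW hnn hWn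
      (tinner_AdLin_self_le (abs_le.2 hp.1) (abs_le.2 hp.2) hvv) hdet
  refine (ENNReal.div_le_of_le_mul' ?_ : mU _ ≤ _)
  refine (measure_mono hsub).trans <| (hvol _ a b _ _ (by positivity) (by positivity) hab).trans ?_
  refine le_trans (ENNReal.ofReal_le_ofReal ?_) (le_mul_of_one_le_left' (by norm_num))
  rw [hnorm, mul_assoc C, mul_assoc C]
  refine mul_le_mul_of_nonneg_left ?_ (by linarith)
  have hρκ : 0 ≤ ρ ^ κ := Real.rpow_nonneg hρ.le κ
  have h1 : (640000 : ℝ) ^ κ ≤ 640000 := by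
    simpa using Real.rpow_le_rpow_of_exponent_le (by norm_num : (1 : ℝ) ≤ 640000) hκ1
  have h2 : (|x 0| ^ (-5 : ℝ)) ^ κ ≤ |x 0| ^ (-5 : ℝ) := by
    simpa using Real.rpow_le_rpow_of_exponent_le
      (Real.one_le_rpow_of_pos_of_le_one_of_nonpos hpos (hx 0) (by norm_num : (-5 : ℝ) ≤ 0)) hκ1
  have h3 : 64 * ρ / (|x 0| ^ 5 / 10000) = 640000 * |x 0| ^ (-5 : ℝ) * ρ := by
    rw [Real.rpow_neg hpos.le]
    norm_cast
    field_simp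
    norm_num
  rw [h3, Real.mul_rpow (by positivity) hρ.le, Real.mul_rpow (by positivity) (by positivity)]
  gcongr
end
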